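/- Let G₀ be a discrete convergence group acting on a compact metrizable space M, let J₁, J₋₁ ≤ G₀ be geometrically finite subgroups, and let f ∈ Homeo(M) generate an infinite cyclic discrete convergence group with f J₋₁ f⁻¹ = J₁. Suppose G₀ is in HNN ping-pong position with respect to f, J₁ and J₋₁. Let G = ⟨G₀, f⟩ ≤ Homeo(M) and suppose G acts on M as a convergence group. Then every element of G which is not conjugate in G into G₀ is loxodromic. -/

import Mathlib

open Filter Topology Set

namespace ConvergenceGroups

variable {M : Type*} [TopologicalSpace M]

/-- The group of self-homeomorphisms of `M`, with `(g * h) x = g (h x)`. -/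
instance : Group (M ≃ₜ M) where
  mul g h := h.trans g
  one := Homeomorph.refl M
  inv := Homeomorph.symm
  mul_assoc _ _ _ := rfl
  one_mul _ := Homeomorph.ext fun _ => rfl
  mul_one _ := Homeomorph.ext fun _ => rfl
  inv_mul_cancel g := Homeomorph.ext fun x => g.symm_apply_apply x

/-- The inclusion of the self-homeomorphisms of `M` into the continuous self-maps of `M`;
the latter carries the compact-open topology. -/
def toCM (g : M ≃ₜ M) : C(M, M) := ⟨⇑g, g.continuous⟩

/-- `(g k)` is a convergence sequence with attracting point `zp` and repelling point `zm`:
the maps `g k` converge to the constant map `zp` uniformly on compact subsets of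
`M ∖ {zm}`. -/
def IsConvSeq (g : ℕ → M ≃ₜ M) (zp zm : M) : Prop :=
  ∀ K : Set M, IsCompact K → zm ∉ K → ∀ U ∈ 𝓝 zp,
    ∀ᶠ k in atTop, ∀ x ∈ K, g k x ∈ U

/-- `(g k)` converges in the compact-open topology to a homeomorphism. -/
def TendstoHomeo (g : ℕ → M ≃ₜ M) : Prop :=
  ∃ h : M ≃ₜ M, Tendsto (fun k => toCM (g k)) atTop (𝓝 (toCM h))

/-- `G` acts on `M` as a convergence group: every sequence of pairwise distinct elements of
`G` has a subsequence which either converges in the compact-open topology to a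
homeomorphism, or is a convergence sequence. -/
def IsConvGroup (G : Subgroup (M ≃ₜ M)) : Prop :=
  ∀ g : ℕ → M ≃ₜ M, (∀ k, g k ∈ G) → Function.Injective g →
    ∃ φ : ℕ → ℕ, StrictMono φ ∧
      (TendstoHomeo (g ∘ φ) ∨ ∃ zp zm : M, IsConvSeq (g ∘ φ) zp zm)

/-- `G` acts on `M` as a discrete convergence group: every sequence of pairwise distinct
elements of `G` has a subsequence which is a convergence sequence. -/
def IsDiscreteConvGroup (G : Subgroup (M ≃ₜ M)) : Prop :=
  ∀ g : ℕ → M ≃ₜ M, (∀ k, g k ∈ G) → Function.Injective g →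
    ∃ φ : ℕ → ℕ, StrictMono φ ∧ ∃ zp zm : M, IsConvSeq (g ∘ φ) zp zm

/-- The limit set `Λ(G)`: the set of all attracting points of convergence sequences in `G`. -/
def limitSet (G : Subgroup (M ≃ₜ M)) : Set M :=
  {zp | ∃ g : ℕ → M ≃ₜ M, (∀ k, g k ∈ G) ∧ Function.Injective g ∧
    ∃ zm : M, IsConvSeq g zp zm}

/-- `x` is a conical limit point for `G`: there is a sequence of pairwise distinct elements
`g k` of `G` such that for every `z ≠ x` the pairs `(g k x, g k z)` remain in a compact
subset of `(M × M) ∖ Δ`. -/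
def IsConicalLimitPt (G : Subgroup (M ≃ₜ M)) (x : M) : Prop :=
  ∃ g : ℕ → M ≃ₜ M, (∀ k, g k ∈ G) ∧ Function.Injective g ∧
    ∀ z : M, z ≠ x → ∃ K : Set (M × M), IsCompact K ∧ (∀ p ∈ K, p.1 ≠ p.2) ∧
      ∀ k, (g k x, g k z) ∈ K

/-- `g` is elliptic: the closure of the cyclic group generated by `g` is compact in
`Homeo(M)` (viewed inside `C(M, M)` with the compact-open topology). -/
def IsEllipticElem (g : M ≃ₜ M) : Prop :=
  IsCompact (closure (Set.range fun n : ℤ => toCM (g ^ n))) ∧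
    closure (Set.range fun n : ℤ => toCM (g ^ n)) ⊆ Set.range (toCM (M := M))

/-- `g` is parabolic: not elliptic, and fixes exactly one point of `M`. -/
def IsParabolicElem (g : M ≃ₜ M) : Prop :=
  ¬IsEllipticElem g ∧ ∃! x : M, g x = x

/-- `g` is loxodromic: not elliptic, and fixes exactly two points of `M`. -/
def IsLoxodromicElem (g : M ≃ₜ M) : Prop :=
  ¬IsEllipticElem g ∧ ∃ a b : M, a ≠ b ∧ {x : M | g x = x} = {a, b}

/-- `p` is a parabolic point for `G`: it is the fixed point of a parabolic element of `G`. -/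
def IsParabolicPt (G : Subgroup (M ≃ₜ M)) (p : M) : Prop :=
  ∃ g ∈ G, IsParabolicElem g ∧ g p = p

/-- `p` is a bounded parabolic point for `G`: it is a parabolic point and the quotient of
`Λ(G) ∖ {p}` by the stabilizer of `p` in `G` is compact. -/
def IsBoundedParabolicPt (G : Subgroup (M ≃ₜ M)) (p : M) : Prop :=
  IsParabolicPt G p ∧
    ∃ K : Set M, IsCompact K ∧ K ⊆ limitSet G \ {p} ∧
      ∀ x ∈ limitSet G \ {p}, ∃ h ∈ G, h p = p ∧ h x ∈ K

/-- `G` is geometrically finite: every point of `Λ(G)` is a conical limit point or a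
bounded parabolic point. -/
def IsGeomFinite (G : Subgroup (M ≃ₜ M)) : Prop :=
  ∀ x ∈ limitSet G, IsConicalLimitPt G x ∨ IsBoundedParabolicPt G x

/-- `J` is a fully quasi-convex subgroup of `G`: `J ≤ G`, `J` acts geometrically finitely,
and `g Λ(J) ∩ Λ(J) = ∅` for all but finitely many left cosets `gJ`. -/
def IsFullyQuasiconvex (G J : Subgroup (M ≃ₜ M)) : Prop :=
  J ≤ G ∧ IsGeomFinite J ∧
    ∃ F : Set (M ≃ₜ M), F.Finite ∧ ∀ g ∈ G,
      (⇑g '' limitSet J ∩ limitSet J).Nonempty → ∃ f ∈ F, ∃ j ∈ J, g = f * j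

/-- `G₁` and `G₂` are in AFP ping-pong position with respect to `J = G₁ ∩ G₂`, witnessed by
the closed sets `B₁`, `B₂`. -/
structure AFPPingPong (G₁ G₂ J : Subgroup (M ≃ₜ M)) (B₁ B₂ : Set M) : Prop where
  isClosed₁ : IsClosed B₁
  isClosed₂ : IsClosed B₂
  int_nonempty₁ : (interior B₁).Nonempty
  int_nonempty₂ : (interior B₂).Nonempty
  int_disjoint : interior B₁ ∩ interior B₂ = ∅
  inv₁ : ∀ j ∈ J, ⇑j '' B₁ = B₁
  inv₂ : ∀ j ∈ J, ⇑j '' B₂ = B₂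
  pp₁ : ∀ g ∈ G₁, g ∉ J → ⇑g '' B₁ ⊆ interior B₂
  pp₂ : ∀ g ∈ G₂, g ∉ J → ⇑g '' B₂ ⊆ interior B₁
  lim₁ : limitSet G₁ \ limitSet J ⊆ interior B₂
  lim₂ : limitSet G₂ \ limitSet J ⊆ interior B₁

/-- `G₀` is in HNN ping-pong position with respect to `f`, `J₁`, `J₋₁`, witnessed by the
closed sets `B₁`, `Bm` (where `Bm` plays the role of `B₋₁`). -/
structure HNNPingPong (G₀ J₁ Jm : Subgroup (M ≃ₜ M)) (f : M ≃ₜ M) (B₁ Bm : Set M) :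
    Prop where
  isClosed₁ : IsClosed B₁
  isClosedm : IsClosed Bm
  int_nonempty₁ : (interior B₁).Nonempty
  int_nonemptym : (interior Bm).Nonempty
  int_disjoint : interior B₁ ∩ interior Bm = ∅
  inv₁ : ∀ j ∈ J₁, ⇑j '' B₁ = B₁
  invm : ∀ j ∈ Jm, ⇑j '' Bm = Bm
  prec₁ : ∀ g ∈ G₀, g ∉ J₁ → ⇑g '' B₁ ∩ B₁ = ∅
  precm : ∀ g ∈ G₀, g ∉ Jm → ⇑g '' Bm ∩ Bm = ∅
  cross : ∀ g ∈ G₀, ⇑g '' B₁ ∩ Bm = ∅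
  mapf : ⇑f '' ((B₁ ∪ Bm)ᶜ ∪ B₁) = interior B₁
  lim₁ : limitSet G₀ ∩ B₁ = limitSet J₁
  limm : limitSet G₀ ∩ Bm = limitSet Jm
  proper : (⋃ g ∈ G₀, ⇑g '' (B₁ ∪ Bm))ᶜ.Nonempty

/-- A letter of type `i` (`i = 0` for `G₁`, `i = 1` for `G₂`) for amalgamated free product
normal forms: an element of `G_{i+1} ∖ J`. -/
def AFPLetter (G₁ G₂ J : Subgroup (M ≃ₜ M)) (i : Fin 2) (g : M ≃ₜ M) : Prop :=
  g ∈ (if i = 0 then G₁ else G₂) ∧ g ∉ J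

/-- `h` is an `(i,j)`-form: a product of a nonempty alternating list of letters, whose first
letter lies in `G_i ∖ J` and whose last letter lies in `G_j ∖ J` (indices shifted so that
`0` stands for `G₁` and `1` for `G₂`). -/
def IsIJForm (G₁ G₂ J : Subgroup (M ≃ₜ M)) (i j : Fin 2) (h : M ≃ₜ M) : Prop :=
  ∃ l : List (M ≃ₜ M), l ≠ [] ∧ l.prod = h ∧
    (∀ g ∈ l, AFPLetter G₁ G₂ J 0 g ∨ AFPLetter G₁ G₂ J 1 g) ∧
    l.Chain' (fun a b => ∀ c : Fin 2, AFPLetter G₁ G₂ J c a → AFPLetter G₁ G₂ J (1 - c) b) ∧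
    (∀ hne : l ≠ [], AFPLetter G₁ G₂ J i (l.head hne)) ∧
    (∀ hne : l ≠ [], AFPLetter G₁ G₂ J j (l.getLast hne))

@[simp]
theorem homeo_mul_apply (g h : M ≃ₜ M) (x : M) : (g * h) x = g (h x) := rfl

@[simp]
theorem homeo_one_apply (x : M) : (1 : M ≃ₜ M) x = x := rfl

@[simp]
theorem homeo_inv_apply_self (g : M ≃ₜ M) (x : M) : g⁻¹ (g x) = x := g.symm_apply_apply x

@[simp]
theorem homeo_apply_inv_self (g : M ≃ₜ M) (x : M) : g (g⁻¹ x) = x := g.apply_symm_apply x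

theorem IsConvSeq.tendsto [T1Space M] {g : ℕ → M ≃ₜ M} {zp zm x : M} (h : IsConvSeq g zp zm)
    (hx : x ≠ zm) : Tendsto (fun k => g k x) atTop (𝓝 zp) := by
  refine tendsto_def.2 fun U hU => ?_
  filter_upwards [h {x} isCompact_singleton (by simpa using hx.symm) U hU] with k hk
  exact hk x rfl

section NorthSouth

variable {w : M ≃ₜ M} {B C : Set M}

theorem pow_mem_of_forall_notMem (hBC : Disjoint B C) (hmap : ∀ x, x ∉ C → w x ∈ B) {x : M}
    (hx : x ∉ C) (k : ℕ) : (w ^ (k + 1)) x ∈ B := by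
  induction k with
  | zero => simpa using hmap x hx
  | succ k ih =>
    rw [pow_succ', homeo_mul_apply]
    exact hmap _ (hBC.notMem_of_mem_left ih)

/-- If `w` maps the complement of `C` into a closed set `B` disjoint from `C`, and `B ∪ C` is
not everything, then the positive powers of `w` do not accumulate at a homeomorphism. -/
theorem not_mapClusterPt_pow [T1Space M] [CompactSpace M] (hB : IsClosed B)
    (hBC : Disjoint B C) (hmap : ∀ x, x ∉ C → w x ∈ B) {a : M} (haB : a ∉ B) (haC : a ∉ C)
    (h : M ≃ₜ M) : ¬MapClusterPt (toCM h) atTop (fun k : ℕ => toCM (w ^ k)) := by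
  intro hc
  have hmem : ∀ k : ℕ, h a ∈ ⇑(w ^ k) '' B := by
    intro k
    by_contra hk
    have hcl : IsClosed (⇑(w ^ k) '' B) := (w ^ k).isClosedMap _ hB
    have hopen : IsOpen {φ : C(M, M) | φ a ∈ (⇑(w ^ k) '' B)ᶜ} :=
      hcl.isOpen_compl.preimage (continuous_eval_const a)
    have hfr := mapClusterPt_iff_frequently.1 hc _ (hopen.mem_nhds hk)
    obtain ⟨j, hj, hj'⟩ := (hfr.and_eventually (eventually_ge_atTop (k + 1))).exists
    obtain ⟨m, rfl⟩ := Nat.exists_eq_add_of_le hj'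
    refine hj ⟨(w ^ (m + 1)) a, pow_mem_of_forall_notMem hBC hmap haC m, ?_⟩
    rw [← homeo_mul_apply, ← pow_add, show k + (m + 1) = k + 1 + m by ring]
    rfl
  have hopen : IsOpen {φ : C(M, M) | MapsTo φ B {h a}ᶜ} :=
    ContinuousMap.isOpen_setOfPred_mapsTo hB.isCompact isOpen_compl_singleton
  have hin : toCM h ∈ {φ : C(M, M) | MapsTo φ B {h a}ᶜ} := fun x hx hxa =>
    haB (h.injective hxa ▸ hx)
  obtain ⟨k, hk⟩ := (mapClusterPt_iff_frequently.1 hc _ (hopen.mem_nhds hin)).exists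
  obtain ⟨b, hb, hba⟩ := hmem k
  exact hk hb hba

/-- An element of a convergence group which maps the complement of a closed set `C` into a
closed set `B` disjoint from `C`, with `B ∪ C` not everything, is loxodromic. -/
theorem isLoxodromicElem_of_mapsTo_compl [T2Space M] [CompactSpace M] {G : Subgroup (M ≃ₜ M)}
    (hG : IsConvGroup G) (hw : w ∈ G) (hB : IsClosed B) (hC : IsClosed C)
    (hBne : B.Nonempty) (hCne : C.Nonempty) (hBC : Disjoint B C)
    (hmap : ∀ x, x ∉ C → w x ∈ B) {a : M} (haB : a ∉ B) (haC : a ∉ C) :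
    IsLoxodromicElem w := by
  have hnc := not_mapClusterPt_pow hB hBC hmap haB haC
  refine ⟨fun ⟨hcpt, hsub⟩ => ?_, ?_⟩
  · have hev : ∃ᶠ k : ℕ in atTop,
        toCM (w ^ k) ∈ closure (Set.range fun n : ℤ => toCM (w ^ n)) :=
      Frequently.of_forall fun k => subset_closure ⟨k, by simp⟩
    obtain ⟨φ, hφ, hcl⟩ := hcpt.exists_mapClusterPt_of_frequently hev
    obtain ⟨h, rfl⟩ := hsub hφ
    exact hnc h hcl
  have hstep : ∀ x k, x ∉ C → (w ^ (k + 1)) x ∈ B := fun x k hx =>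
    pow_mem_of_forall_notMem hBC hmap hx k
  have hinj : Function.Injective fun k : ℕ => w ^ k := by
    refine Function.Injective.of_lt_imp_ne fun k l hkl heq => ?_
    obtain ⟨m, rfl⟩ := Nat.exists_eq_add_of_lt hkl
    have h1 : w ^ (m + 1) = 1 := by
      have : w ^ k * w ^ (m + 1) = w ^ k * 1 := by
        rw [← pow_add, mul_one]; exact heq.symm
      exact mul_left_cancel this
    have := hstep a m haC
    rw [h1] at this
    exact haB this
  obtain ⟨φ, hφ, ⟨h, hh⟩ | ⟨zp, zm, hz⟩⟩ := hG (fun k : ℕ => w ^ k) (fun k => G.pow_mem hw k) hinj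
  · exact absurd (MapClusterPt.of_comp hφ.tendsto_atTop hh.mapClusterPt) (hnc h)
  have hCk : ∃ x, ∀ k : ℕ, (w ^ k) x ∈ C := by
    have hanti : ∀ k, ⇑(w ^ (k + 1)) ⁻¹' C ⊆ ⇑(w ^ k) ⁻¹' C := by
      intro k x hx
      by_contra hxk
      have : (w ^ (k + 1)) x ∈ B := by
        rw [pow_succ', homeo_mul_apply]; exact hmap _ hxk
      exact hBC.notMem_of_mem_left this hx
    obtain ⟨x, hx⟩ := IsCompact.nonempty_iInter_of_sequence_nonempty_isCompact_isClosed
      (fun k : ℕ => ⇑(w ^ k) ⁻¹' C) hanti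
      (fun k => hCne.preimage (w ^ k).surjective)
      (hC.preimage (w ^ 0).continuous).isCompact
      (fun k => hC.preimage (w ^ k).continuous)
    exact ⟨x, fun k => mem_iInter.1 hx k⟩
  have htends : ∀ x, x ≠ zm → Tendsto (fun k => (w ^ φ k) x) atTop (𝓝 zp) := fun x hx =>
    hz.tendsto hx
  have hzpB : ∀ x, x ∉ C → x ≠ zm → zp ∈ B := fun x hxC hx => by
    refine hB.mem_of_tendsto (htends x hx) ?_
    filter_upwards [hφ.tendsto_atTop.eventually (eventually_ge_atTop 1)] with k hk
    obtain ⟨m, hm⟩ := Nat.exists_eq_add_of_le' hk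
    rw [hm]
    exact hstep x m hxC
  have hzpC : ∀ x, (∀ k : ℕ, (w ^ k) x ∈ C) → x ≠ zm → zp ∈ C := fun x hxC hx =>
    hC.mem_of_tendsto (htends x hx) (Eventually.of_forall fun k => hxC _)
  obtain ⟨c, hc⟩ := hCk
  have hzmB : zm ∉ B := fun hzm =>
    hBC.notMem_of_mem_left (hzpB a haC fun h => haB (h ▸ hzm))
      (hzpC c hc fun h => hBC.notMem_of_mem_left hzm (h ▸ hc 0))
  obtain ⟨b, hb⟩ := hBne
  have hneB : ∀ x ∈ B, x ≠ zm := fun x hx h => hzmB (h ▸ hx)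
  have hzp : zp ∈ B := hzpB b (hBC.notMem_of_mem_left hb) (hneB b hb)
  have huniq : ∀ x, (∀ k : ℕ, (w ^ k) x ∈ C) → x = zm := fun x hx => by
    by_contra hne
    exact hBC.notMem_of_mem_left hzp (hzpC x hx hne)
  have hczm := huniq c hc
  subst hczm
  have hfixm : w c = c := huniq _ fun k => by
    rw [← homeo_mul_apply, ← pow_succ]; exact hc (k + 1)
  have hfixp : w zp = zp := by
    have hwb : w b ∈ B := hmap _ (hBC.notMem_of_mem_left hb)
    refine tendsto_nhds_unique ((w.continuous.tendsto zp).comp (htends b (hneB b hb))) ?_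
    refine (htends (w b) (hneB _ hwb)).congr fun k => ?_
    rw [← homeo_mul_apply, ← pow_succ, pow_succ']
    rfl
  refine ⟨zp, c, hneB zp hzp, ?_⟩
  ext x
  simp only [mem_ofPred_eq, mem_insert_iff, mem_singleton_iff]
  refine ⟨fun hx => ?_, ?_⟩
  · have hpow : ∀ k : ℕ, (w ^ k) x = x := fun k => by
      induction k with
      | zero => rfl
      | succ k ih => rw [pow_succ, homeo_mul_apply, hx, ih]
    by_cases hxC : x ∈ C
    · exact Or.inr (huniq x fun k => (hpow k).symm ▸ hxC)
    · have hxB : x ∈ B := hx ▸ hmap x hxC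
      have := htends x (hneB x hxB)
      simp only [hpow] at this
      exact Or.inl (tendsto_nhds_unique tendsto_const_nhds this)
  · rintro (rfl | rfl) <;> assumption

end NorthSouth

section Words

variable {H : Type*} [Group H]

/-- The product of the word in an HNN extension whose letters are the pairs `(ε, x)`, the letter
`(ε, x)` standing for `F ε * x`. -/
def wordProd (F : Bool → H) (l : List (Bool × H)) : H :=
  (l.map fun p => F p.1 * p.2).prod

@[simp]
theorem wordProd_nil (F : Bool → H) : wordProd F [] = 1 := rfl

@[simp]
theorem wordProd_cons (F : Bool → H) (p : Bool × H) (l : List (Bool × H)) :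
    wordProd F (p :: l) = F p.1 * p.2 * wordProd F l := by
  simp [wordProd]

@[simp]
theorem wordProd_append (F : Bool → H) (l l' : List (Bool × H)) :
    wordProd F (l ++ l') = wordProd F l * wordProd F l' := by
  simp [wordProd]

theorem wordProd_mem {F : Bool → H} {G : Subgroup H} (hF : ∀ ε, F ε ∈ G) {l : List (Bool × H)}
    (hl : ∀ p ∈ l, p.2 ∈ G) : wordProd F l ∈ G :=
  list_prod_mem fun y hy => by
    obtain ⟨p, hp, rfl⟩ := List.mem_map.1 hy
    exact G.mul_mem (hF _) (hl p hp)

theorem exists_eq_mul_wordProd {G₀ : Subgroup H} {F : Bool → H} (hF : F false = (F true)⁻¹)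
    {g : H} (hg : g ∈ G₀ ⊔ Subgroup.zpowers (F true)) :
    ∃ x ∈ G₀, ∃ l : List (Bool × H), (∀ p ∈ l, p.2 ∈ G₀) ∧ g = x * wordProd F l := by
  rw [Subgroup.zpowers_eq_closure, ← Subgroup.closure_eq G₀, ← Subgroup.closure_union] at hg
  have hletter : ∀ ε y, (∃ x ∈ G₀, ∃ l : List (Bool × H), (∀ p ∈ l, p.2 ∈ G₀) ∧
      y = x * wordProd F l) → ∃ x ∈ G₀, ∃ l : List (Bool × H), (∀ p ∈ l, p.2 ∈ G₀) ∧
      F ε * y = x * wordProd F l := by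
    rintro ε y ⟨x, hx, l, hl, rfl⟩
    exact ⟨1, G₀.one_mem, (ε, x) :: l, by simpa [hx] using hl, by simp [mul_assoc]⟩
  induction hg using Subgroup.closure_induction_left with
  | one => exact ⟨1, G₀.one_mem, [], by simp, by simp⟩
  | mul_left u hu y _ ih =>
    rcases hu with hu | rfl
    · obtain ⟨x, hx, l, hl, rfl⟩ := ih
      exact ⟨u * x, G₀.mul_mem hu hx, l, hl, by simp [mul_assoc]⟩
    · exact hletter true y ih
  | inv_mul_cancel u hu y _ ih =>
    rcases hu with hu | rfl
    · obtain ⟨x, hx, l, hl, rfl⟩ := ih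
      exact ⟨u⁻¹ * x, G₀.mul_mem (G₀.inv_mem hu) hx, l, hl, by simp [mul_assoc]⟩
    · rw [← hF]
      exact hletter false y ih

/-- An element of `G = ⟨G₀, F true⟩` which is not conjugate into `G₀` is conjugate to the product
of a nonempty cyclically reduced word. -/
theorem exists_cyclically_reduced_word {G₀ G : Subgroup H} {F : Bool → H} {J : Bool → Subgroup H}
    (hF : F false = (F true)⁻¹) (hG : G = G₀ ⊔ Subgroup.zpowers (F true))
    (hJ : ∀ ε, ∀ x ∈ J (!ε), F ε * x * F (!ε) ∈ G₀) {g : H} (hg : g ∈ G)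
    (hconj : ¬∃ h ∈ G, h⁻¹ * g * h ∈ G₀) :
    ∃ h ∈ G, ∃ (p : Bool × H) (l : List (Bool × H)), (∀ q ∈ p :: l, q.2 ∈ G₀) ∧
      h⁻¹ * g * h = wordProd F (p :: l) ∧
      (p :: l).IsChain (fun a b => b.1 = !a.1 → a.2 ∉ J (!a.1)) ∧
      (p.1 = !((p :: l).getLast (by simp)).1 →
        ((p :: l).getLast (by simp)).2 ∉ J (!((p :: l).getLast (by simp)).1)) := by
  have hG₀G : G₀ ≤ G := hG ▸ le_sup_left
  have hfG : F true ∈ G := hG ▸ (le_sup_right : _ ≤ G₀ ⊔ _) (Subgroup.mem_zpowers _)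
  have hFG : ∀ ε, F ε ∈ G := by
    rintro (_ | _)
    · exact hF ▸ G.inv_mem hfG
    · exact hfG
  let Rep : List (Bool × H) → Prop := fun l =>
    (∀ q ∈ l, q.2 ∈ G₀) ∧ ∃ h ∈ G, h⁻¹ * g * h = wordProd F l
  have hne : ∀ l, Rep l → l ≠ [] := by
    rintro _ ⟨-, h, hh, he⟩ rfl
    exact hconj ⟨h, hh, by rw [he]; exact G₀.one_mem⟩
  have habsorb : ∀ x ∈ G₀, ∀ l : List (Bool × H), (∀ q ∈ l, q.2 ∈ G₀) →
      (∃ h ∈ G, h⁻¹ * g * h = x * wordProd F l) → ∃ l', Rep l' ∧ l'.length = l.length := by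
    rintro x hx l hl ⟨h, hh, he⟩
    rcases List.eq_nil_or_concat l with rfl | ⟨l₀, q, rfl⟩
    · exact absurd ⟨h, hh, by rw [he]; simpa using hx⟩ hconj
    · rw [List.concat_eq_append] at *
      refine ⟨l₀ ++ [(q.1, q.2 * x)], ⟨?_, h * x, G.mul_mem hh (hG₀G hx), ?_⟩, by simp⟩
      · intro r hr
        rcases List.mem_append.1 hr with hr | hr
        · exact hl r (by simp [hr])
        · rw [List.mem_singleton.1 hr]
          exact G₀.mul_mem (hl q (by simp)) hx
      · calc (h * x)⁻¹ * g * (h * x) = x⁻¹ * (h⁻¹ * g * h) * x := by group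
          _ = _ := by rw [he]; simp [mul_assoc]
  have hrot : ∀ l l', Rep (l ++ l') → Rep (l' ++ l) := by
    rintro l l' ⟨hl, h, hh, he⟩
    have hlG : wordProd F l ∈ G := wordProd_mem hFG fun q hq => hG₀G (hl q (by simp [hq]))
    refine ⟨fun q hq => hl q (by simpa [or_comm] using hq), h * wordProd F l, G.mul_mem hh hlG, ?_⟩
    calc (h * wordProd F l)⁻¹ * g * (h * wordProd F l)
        = (wordProd F l)⁻¹ * (h⁻¹ * g * h) * wordProd F l := by group
      _ = _ := by rw [he]; simp
  have hex : ∃ n, ∃ l, Rep l ∧ l.length = n := by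
    obtain ⟨x, hx, l, hl, he⟩ := exists_eq_mul_wordProd hF (hG ▸ hg)
    exact ⟨_, habsorb x hx l hl ⟨1, G.one_mem, by simpa using he⟩⟩
  classical
  obtain ⟨l, hl, hlen⟩ := Nat.find_spec hex
  have hmin : ∀ l', Rep l' → l.length ≤ l'.length := fun l' hl' =>
    hlen ▸ Nat.find_min' hex ⟨l', hl', rfl⟩
  have hred : ∀ a b l', Rep (a :: b :: l') → (a :: b :: l').length = l.length →
      b.1 = !a.1 → a.2 ∉ J (!a.1) := by
    rintro ⟨ε, x⟩ ⟨δ, y⟩ l' ⟨hl', h, hh, he⟩ hlen' rfl hx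
    obtain ⟨l'', hl'', hlen''⟩ := habsorb (F ε * x * F (!ε) * y)
      (G₀.mul_mem (hJ ε x hx) (hl' (!ε, y) (by simp))) l'
      (fun q hq => hl' q (by simp [hq])) ⟨h, hh, by rw [he]; simp [mul_assoc]⟩
    have := hmin l'' hl''
    simp only [List.length_cons] at hlen'
    omega
  obtain ⟨p, t, rfl⟩ := List.exists_cons_of_ne_nil (hne l hl)
  obtain ⟨hl₀, h, hh, he⟩ := id hl
  refine ⟨h, hh, p, t, hl₀, he, ?_, ?_⟩
  · rw [List.isChain_iff_forall_rel_of_append_cons_cons]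
    intro a b l₁ l₂ heq
    refine hred a b (l₂ ++ l₁) (hrot l₁ (a :: b :: l₂) (heq ▸ hl)) ?_
    rw [heq]
    simp only [List.length_append, List.length_cons]
    omega
  · rcases List.eq_nil_or_concat t with rfl | ⟨t₀, q, rfl⟩
    · intro h
      simp at h
    · have hlast : (p :: t₀.concat q).getLast (by simp) = q := by simp
      rw [hlast]
      rw [List.concat_eq_append] at hl
      exact hred q p t₀ (hrot (p :: t₀) [q] hl) (by simp)

end Words

/-- Ping-pong for reduced words: if each letter `(ε, x)` of the word sends the target region
of the next one away from the region repelled by `F ε`, then the product of the word sends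
everything outside the region repelled by its last letter into the target region of its
first letter. -/
theorem wordProd_apply_mem {F : Bool → M ≃ₜ M} {B : Bool → Set M}
    (hF : ∀ ε, ∀ x, x ∉ B (!ε) → F ε x ∈ B ε) (l : List (Bool × (M ≃ₜ M)))
    (p : Bool × (M ≃ₜ M))
    (hl : (p :: l).IsChain fun a b => ∀ x ∈ B b.1, a.2 x ∉ B (!a.1)) (x : M)
    (hx : ((p :: l).getLast (by simp)).2 x ∉ B (!((p :: l).getLast (by simp)).1)) :
    wordProd F (p :: l) x ∈ B p.1 := by
  induction l generalizing p with
  | nil => simpa using hF _ _ hx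
  | cons q l ih =>
    rw [List.isChain_cons_cons] at hl
    rw [wordProd_cons, homeo_mul_apply, homeo_mul_apply]
    refine hF _ _ (hl.1 _ (ih q hl.2 ?_))
    rwa [List.getLast_cons (by simp)] at hx

/-- **Theorem B(iii).** With `G₀` a discrete convergence group,
`J₁, J₋₁ ≤ G₀` geometrically finite, `f` generating an infinite cyclic discrete
convergence group with `f J₋₁ f⁻¹ = J₁`, `G₀` in HNN ping-pong position, and
`G = ⟨G₀, f⟩` acting as a convergence group: every element of `G` which is not
conjugate in `G` into `G₀` is loxodromic. -/
theorem statement_10 {M : Type*} [TopologicalSpace M] [CompactSpace M]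
    [TopologicalSpace.MetrizableSpace M]
    (G₀ J₁ Jm G : Subgroup (M ≃ₜ M)) (f : M ≃ₜ M)
    (hd₀ : IsDiscreteConvGroup G₀)
    (hJ₁G₀ : J₁ ≤ G₀) (hJmG₀ : Jm ≤ G₀)
    (hJ₁gf : IsGeomFinite J₁) (hJmgf : IsGeomFinite Jm)
    (hford : ¬IsOfFinOrder f) (hfd : IsDiscreteConvGroup (Subgroup.zpowers f))
    (hconj : ∀ x : M ≃ₜ M, x ∈ J₁ ↔ f⁻¹ * x * f ∈ Jm)
    (hpp : ∃ B₁ Bm : Set M, HNNPingPong G₀ J₁ Jm f B₁ Bm)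
    (hG : G = G₀ ⊔ Subgroup.zpowers f) (hGconv : IsConvGroup G) :
    ∀ g ∈ G, (¬∃ h ∈ G, h⁻¹ * g * h ∈ G₀) → IsLoxodromicElem g := by
  obtain ⟨B₁, Bm, hP⟩ := hpp
  intro g hg hnc
  let F : Bool → M ≃ₜ M := fun ε => cond ε f f⁻¹
  let B : Bool → Set M := fun ε => cond ε B₁ Bm
  let J : Bool → Subgroup (M ≃ₜ M) := fun ε => cond ε J₁ Jm
  have hJG₀ : ∀ ε, J ε ≤ G₀ := by rintro (_ | _) <;> assumption
  have hBcl : ∀ ε, IsClosed (B ε) := by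
    rintro (_ | _)
    exacts [hP.isClosedm, hP.isClosed₁]
  have hBne : ∀ ε, (B ε).Nonempty := by
    rintro (_ | _)
    exacts [hP.int_nonemptym.mono interior_subset, hP.int_nonempty₁.mono interior_subset]
  have hJ : ∀ ε, ∀ x ∈ J (!ε), F ε * x * F (!ε) ∈ J ε := by
    rintro (_ | _) x hx
    · exact (hconj x).1 hx
    · refine (hconj _).2 ?_
      have : f⁻¹ * (f * x * f⁻¹) * f = x := by group
      exact this.symm ▸ hx
  have hcross : ∀ ε, ∀ y ∈ G₀, ∀ x ∈ B ε, y x ∉ B (!ε) := by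
    rintro (_ | _) y hy x hx hyx
    · have : x ∈ ⇑y⁻¹ '' B₁ ∩ Bm := ⟨⟨y x, hyx, by simp⟩, hx⟩
      rw [hP.cross _ (G₀.inv_mem hy)] at this
      exact this
    · have : y x ∈ ⇑y '' B₁ ∩ Bm := ⟨⟨x, hx, rfl⟩, hyx⟩
      rw [hP.cross _ hy] at this
      exact this
  have hprec : ∀ ε, ∀ y ∈ G₀, y ∉ J ε → ∀ x ∈ B ε, y x ∉ B ε := by
    rintro (_ | _) y hy hyJ x hx hyx
    · have : y x ∈ ⇑y '' Bm ∩ Bm := ⟨⟨x, hx, rfl⟩, hyx⟩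
      rw [hP.precm _ hy hyJ] at this
      exact this
    · have : y x ∈ ⇑y '' B₁ ∩ B₁ := ⟨⟨x, hx, rfl⟩, hyx⟩
      rw [hP.prec₁ _ hy hyJ] at this
      exact this
  have hFB : ∀ ε, ∀ x, x ∉ B (!ε) → F ε x ∈ B ε := by
    rintro (_ | _) x hx
    · by_contra hfx
      have : f (f⁻¹ x) ∈ interior B₁ := by
        rw [← hP.mapf]
        refine ⟨f⁻¹ x, ?_, rfl⟩
        by_cases h : f⁻¹ x ∈ B₁
        · exact Or.inr h
        · exact Or.inl fun h' => h'.elim h hfx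
      rw [homeo_apply_inv_self] at this
      exact hx (interior_subset this)
    · refine interior_subset (s := B₁) ?_
      rw [← hP.mapf]
      refine ⟨x, ?_, rfl⟩
      by_cases h : x ∈ B₁
      · exact Or.inr h
      · exact Or.inl fun h' => h'.elim h hx
  obtain ⟨h, hh, p, l, hl, he, hchain, hcyc⟩ :=
    exists_cyclically_reduced_word (F := F) (J := J) rfl hG
      (fun ε x hx => hJG₀ ε (hJ ε x hx)) hg hnc
  have hpair : ∀ a b : Bool × (M ≃ₜ M), a.2 ∈ G₀ → (b.1 = !a.1 → a.2 ∉ J (!a.1)) →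
      ∀ x ∈ B b.1, a.2 x ∉ B (!a.1) := by
    intro a b ha hab x hx
    by_cases hb : b.1 = !a.1
    · exact hprec _ _ ha (hab hb) x (hb ▸ hx)
    · have : b.1 = a.1 := by simpa using hb
      exact hcross _ _ ha x (this ▸ hx)
  set q := (p :: l).getLast (by simp) with hq
  have hqG₀ : q.2 ∈ G₀ := hl q (List.getLast_mem _)
  have hping : ∀ x, q.2 x ∉ B (!q.1) → wordProd F (p :: l) x ∈ B p.1 :=
    wordProd_apply_mem hFB l p
      (hchain.imp_of_mem_imp fun a b ha _ hab => hpair a b (hl a ha) hab)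
  have hgw : ∀ x, h⁻¹ (g x) = wordProd F (p :: l) (h⁻¹ x) := fun x => by
    rw [← he]; simp
  obtain ⟨a, ha⟩ := hP.proper
  have haB : ∀ ε, ∀ y ∈ G₀, y a ∉ B ε := fun ε y hy hya => by
    refine ha (mem_iUnion₂.2 ⟨y⁻¹, G₀.inv_mem hy, y a, ?_, by simp⟩)
    cases ε
    exacts [Or.inr hya, Or.inl hya]
  refine isLoxodromicElem_of_mapsTo_compl (B := ⇑h⁻¹ ⁻¹' B p.1)
    (C := ⇑(q.2 * h⁻¹) ⁻¹' B (!q.1)) (a := h a) hGconv hg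
    ((hBcl _).preimage h⁻¹.continuous) ((hBcl _).preimage (q.2 * h⁻¹).continuous)
    ((hBne _).preimage h⁻¹.surjective) ((hBne _).preimage (q.2 * h⁻¹).surjective)
    ?_ ?_ ?_ ?_
  · exact Set.disjoint_left.2 fun x hx hx' => hpair q p hqG₀ hcyc (h⁻¹ x) hx hx'
  · intro x hx
    rw [mem_preimage, hgw]
    exact hping _ hx
  · simpa using haB p.1 1 G₀.one_mem
  · simpa using haB (!q.1) q.2 hqG₀

end ConvergenceGroups
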